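/- Let (Ω,F,P) be a complete filtered probability space and let X = (X_t)_{t≥0} be an adapted supermartingale whose sample paths are right-continuous with left limits, such that X_0 = 0 almost surely and all jumps of X are nonnegative (for every ω and every t > 0, the left limit X_{t−}(ω) satisfies X_{t−}(ω) ≤ X_t(ω)). Let M⁺_t(ω) = sup_{0≤s≤t} max(X_s(ω), 0) and M⁻_t(ω) = inf_{0≤s≤t} min(X_s(ω), 0). Then for every 0 < p < 1 and every t ≥ 0, E[(M⁺_t)^p] ≤ c_p^p · E[(−M⁻_t)^p], where c_p^p = (1/p − 1)^p + ∫_{1/p−1}^∞ s^{p−1}/(s+1) ds. -/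

import Mathlib

open MeasureTheory Filter Set
open scoped NNReal

/-- The running maximum of `y 1, …, y j`, started from the value `a`. -/
def runMax (a : ℝ) (y : ℕ → ℝ) : ℕ → ℝ
  | 0 => a
  | j + 1 => max (runMax a y j) (y (j + 1))

theorem runMax_mono (a : ℝ) (y : ℕ → ℝ) : Monotone (runMax a y) :=
  monotone_nat_of_le_succ fun _ => le_max_left _ _

theorem le_runMax_init (a : ℝ) (y : ℕ → ℝ) (j : ℕ) : a ≤ runMax a y j :=
  runMax_mono a y (Nat.zero_le j)

theorem le_runMax {a : ℝ} {y : ℕ → ℝ} (h0 : y 0 ≤ a) {i j : ℕ} (hij : i ≤ j) :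
    y i ≤ runMax a y j := by
  refine le_trans ?_ (runMax_mono a y hij)
  cases i with
  | zero => exact h0
  | succ i => exact le_max_right _ _

theorem runMax_le {a b : ℝ} {y : ℕ → ℝ} {j : ℕ} (ha : a ≤ b) (hy : ∀ i ≤ j, y i ≤ b) :
    runMax a y j ≤ b := by
  induction j with
  | zero => exact ha
  | succ j ih => exact max_le (ih fun i hi => hy i (by omega)) (hy _ le_rfl)

theorem rpow_le_tangent {p a b : ℝ} (hp : 0 < p) (hp1 : p < 1) (ha : 0 < a) (hb : 0 < b) :
    b ^ p ≤ a ^ p + p * a ^ (p - 1) * (b - a) := by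
  have h := rpow_one_add_le_one_add_mul_self (s := b / a - 1)
    (by have : 0 < b / a := by positivity
        linarith) hp.le hp1.le
  have e : 1 + (b / a - 1) = b / a := by ring
  rw [e, Real.div_rpow hb.le ha.le, div_le_iff₀ (by positivity)] at h
  rw [Real.rpow_sub_one ha.ne']
  refine h.trans (le_of_eq ?_)
  field_simp

/-- One-step estimate for the Bellman function
`U x m z = z ^ p - c * m ^ p + p * (x + m) * m ^ (p - 1) * g (z / m)`. -/
theorem bellman_step {p κ : ℝ} {g : ℝ → ℝ} (hp : 0 < p) (hp1 : p < 1) (hκ : 0 < κ)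
    (hg0 : ∀ u, 0 ≤ g u) (hga : Antitone g)
    (hgi : ∀ a b, κ ≤ a → a ≤ b → b ^ p - a ^ p ≤ p * (b + 1) * (g a - g b))
    {x m z x' m' z' : ℝ} (hm : 0 < m) (hz : κ * m ≤ z)
    (hm' : m' = max m (-x')) (hz' : z' = max (max z x') (κ * m')) :
    z' ^ p - (κ ^ p + g κ) * m' ^ p + p * (x' + m') * m' ^ (p - 1) * g (z' / m')
      ≤ z ^ p - (κ ^ p + g κ) * m ^ p + p * (x + m) * m ^ (p - 1) * g (z / m)
        + p * m ^ (p - 1) * g (z / m) * (x' - x)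
        + p * g κ * (m' - m) * (m ^ (p - 1) - m' ^ (p - 1)) := by
  have hz0 : 0 < z := lt_of_lt_of_le (by positivity) hz
  rcases le_or_gt (-x') m with h | h
  · have em : m' = m := by rw [hm', max_eq_left h]
    have ez : z' = max z x' := by
      rw [hz', em, max_eq_left (hz.trans (le_max_left _ _))]
    subst em
    rcases le_or_gt x' z with hx | hx
    · rw [ez, max_eq_left hx]
      apply le_of_eq; ring
    · rw [ez, max_eq_right hx.le]
      have hx0 : 0 < x' := hz0.trans hx
      have := hgi (z / m') (x' / m') (by rwa [le_div_iff₀ hm]) (by gcongr)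
      rw [Real.div_rpow hx0.le hm.le, Real.div_rpow hz0.le hm.le, ← sub_div,
        div_le_iff₀ (by positivity)] at this
      have e : p * (x' / m' + 1) * (g (z / m') - g (x' / m')) * m' ^ p
          = p * (x' + m') * m' ^ (p - 1) * (g (z / m') - g (x' / m')) := by
        rw [Real.rpow_sub_one hm.ne']
        field_simp
      rw [e] at this
      linarith
  · have em : m' = -x' := by rw [hm', max_eq_right h.le]
    have hmm : m ≤ m' := by rw [em]; exact h.le
    have hm0 : 0 < m' := hm.trans_le hmm
    have ez : z' = max z (κ * m') := by
      rw [hz', max_eq_left (a := z)]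
      linarith
    have hx' : x' = -m' := by linarith
    have hκz : z' ^ p - z ^ p ≤ κ ^ p * (m' ^ p - m ^ p) := by
      have hmp : m ^ p ≤ m' ^ p := by gcongr
      have hκp : 0 ≤ κ ^ p := by positivity
      rcases le_total z (κ * m') with h1 | h1
      · rw [ez, max_eq_right h1, Real.mul_rpow hκ.le hm0.le]
        have : (κ * m) ^ p ≤ z ^ p := by gcongr
        rw [Real.mul_rpow hκ.le hm.le] at this
        linarith
      · rw [ez, max_eq_left h1]
        have := mul_nonneg hκp (sub_nonneg.2 hmp)
        linarith
    have htan := rpow_le_tangent hp hp1 hm0 hm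
    have hgz : g (z / m) ≤ g κ := hga (by rwa [le_div_iff₀ hm])
    have h1 : p * m ^ (p - 1) * (m' - m) * g (z / m) ≤ p * m ^ (p - 1) * (m' - m) * g κ := by
      have : 0 ≤ m' - m := by linarith
      gcongr
    have h2 := mul_le_mul_of_nonneg_left htan (hg0 κ)
    rw [hx']
    have e : p * (-m' + m') * m' ^ (p - 1) * g (z' / m') = 0 := by ring
    rw [e]
    nlinarith

theorem pathwise_bound {p κ ε η : ℝ} {g : ℝ → ℝ} (hp : 0 < p) (hp1 : p < 1) (hκ : 0 < κ)
    (hε : 0 < ε) (hη : 0 < η) (hg0 : ∀ u, 0 ≤ g u) (hga : Antitone g)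
    (hgi : ∀ a b, κ ≤ a → a ≤ b → b ^ p - a ^ p ≤ p * (b + 1) * (g a - g b))
    {y m z H : ℕ → ℝ} {b : ℕ → Prop} [DecidablePred b] (hy : y 0 = 0)
    (hm : m = runMax ε (-y)) (hz : z = fun j => max (runMax 0 y j) (κ * m j))
    (hb : ∀ j, b j ↔ ∃ i < j, η < m (i + 1) - m i)
    (hH : ∀ j, H j = if b j then p * g κ * ε ^ (p - 1) else p * m j ^ (p - 1) * g (z j / m j))
    (j : ℕ) :
    (if b j then 0 else z j ^ p) ≤ (κ ^ p + g κ) * m j ^ p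
      + ∑ i ∈ Finset.range j, H i * (y (i + 1) - y i) + p * g κ * ε ^ (p - 1) * η
      + p * g κ * ε ^ (p - 1) * (if b j then |y j| else 0) := by
  have hmε : ∀ j, ε ≤ m j := fun j => by rw [hm]; exact le_runMax_init _ _ _
  have hm0 : ∀ j, 0 < m j := fun j => hε.trans_le (hmε j)
  have hmy : ∀ j, -y j ≤ m j := fun j => by
    rw [hm]; exact le_runMax (y := -y) (by simp [hy, hε.le]) le_rfl
  have hms : ∀ j, m j ≤ m (j + 1) := fun j => by rw [hm]; exact runMax_mono _ _ (Nat.le_succ j)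
  have hpw : ∀ j, m (j + 1) ^ (p - 1) ≤ m j ^ (p - 1) := fun j =>
    Real.rpow_le_rpow_of_nonpos (hm0 j) (hms j) (by linarith)
  have hpw0 : ∀ j, m j ^ (p - 1) ≤ ε ^ (p - 1) := fun j =>
    Real.rpow_le_rpow_of_nonpos hε (hmε j) (by linarith)
  have hgκ := hg0 κ
  have hbs : ∀ j, b (j + 1) ↔ b j ∨ η < m (j + 1) - m j := fun j => by
    rw [hb, hb]
    constructor
    · rintro ⟨i, hi, h⟩
      rcases Nat.lt_succ_iff_lt_or_eq.1 hi with h1 | rfl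
      · exact Or.inl ⟨i, h1, h⟩
      · exact Or.inr h
    · rintro (⟨i, hi, h⟩ | h)
      · exact ⟨i, by omega, h⟩
      · exact ⟨j, by omega, h⟩
  have key : ∀ j, (if b j then 0 else z j ^ p + p * (y j + m j) * m j ^ (p - 1) * g (z j / m j))
      ≤ (κ ^ p + g κ) * m j ^ p + ∑ i ∈ Finset.range j, H i * (y (i + 1) - y i)
        + p * g κ * η * (ε ^ (p - 1) - m j ^ (p - 1))
        + (if b j then p * g κ * ε ^ (p - 1) * (-y j) else 0) := by
    intro j
    induction j with
    | zero =>
      have hb0 : ¬ b 0 := by rw [hb]; simp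
      have em : m 0 = ε := by rw [hm]; rfl
      have ez : z 0 = κ * ε := by
        rw [hz]; simp only [em, runMax]; exact max_eq_right (by positivity)
      simp only [hb0, if_false, em, ez, hy, Finset.range_zero, Finset.sum_empty]
      rw [mul_div_assoc, div_self hε.ne', mul_one, Real.mul_rpow hκ.le hε.le,
        Real.rpow_sub_one hε.ne']
      have e : p * (0 + ε) * (ε ^ p / ε) * g κ = p * (g κ * ε ^ p) := by field_simp; ring
      have : 0 ≤ g κ * ε ^ p := by positivity
      rw [e]
      nlinarith
    | succ j ih =>
      have step := bellman_step (g := g) (x := y j) (m := m j) (z := z j) (x' := y (j + 1))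
        (m' := m (j + 1)) (z' := z (j + 1)) hp hp1 hκ hg0 hga hgi (hm0 j)
        (by rw [hz]; exact le_max_right _ _) (by rw [hm]; rfl)
        (by
          have e1 : z (j + 1) = max (max (runMax 0 y j) (y (j + 1))) (κ * m (j + 1)) := by
            rw [hz]; rfl
          have e2 : z j = max (runMax 0 y j) (κ * m j) := by rw [hz]
          have e3 : κ * m j ≤ κ * m (j + 1) := by have := hms j; gcongr
          rw [e1, e2]
          apply le_antisymm
          · refine max_le (max_le ?_ ?_) (le_max_right _ _) <;> simp
          · refine max_le (max_le (max_le ?_ ?_) ?_) ?_ <;> simp [e3])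
      rw [Finset.sum_range_succ, hH]
      have hc : (κ ^ p + g κ) * m j ^ p ≤ (κ ^ p + g κ) * m (j + 1) ^ p := by
        have := hms j; have := (hm0 j).le
        gcongr
      have hη2 : p * g κ * η * m (j + 1) ^ (p - 1) ≤ p * g κ * η * m j ^ (p - 1) := by
        have := hpw j
        gcongr
      by_cases hbj : b j
      · have hbj' : b (j + 1) := (hbs j).2 (Or.inl hbj)
        simp only [hbj, hbj', if_true] at ih ⊢
        linarith
      · by_cases hl : η < m (j + 1) - m j
        · have hbj' : b (j + 1) := (hbs j).2 (Or.inr hl)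
          simp only [hbj, hbj', if_true, if_false] at ih ⊢
          have em : m (j + 1) = - y (j + 1) := by
            have : m (j + 1) = max (m j) (-y (j + 1)) := by rw [hm]; rfl
            rcases max_choice (m j) (-y (j + 1)) with h | h
            · rw [h] at this; linarith
            · rw [h] at this; exact this
          have hz0 : 0 ≤ z (j + 1) ^ p := by
            apply Real.rpow_nonneg
            rw [hz]; exact (le_runMax_init 0 y (j + 1)).trans (le_max_left _ _)
          have h0 : p * (y (j + 1) + m (j + 1)) * m (j + 1) ^ (p - 1) * g (z (j + 1) / m (j + 1))
              = 0 := by rw [em]; ring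
          have herr : p * g κ * (m (j + 1) - m j) * (m j ^ (p - 1) - m (j + 1) ^ (p - 1))
              ≤ p * g κ * ε ^ (p - 1) * (-y (j + 1)) := by
            rw [← em]
            have h1 : 0 ≤ m (j + 1) ^ (p - 1) := Real.rpow_nonneg (hm0 _).le _
            have : p * g κ * ((m (j + 1) - m j) * (m j ^ (p - 1) - m (j + 1) ^ (p - 1)))
              ≤ p * g κ * (m (j + 1) * ε ^ (p - 1)) := by
              have h2 := hpw0 j
              have h3 := hpw j
              have h4 := (hm0 (j + 1)).le
              have h5 := (hm0 j).le
              gcongr <;> linarith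
            linarith
          linarith
        · have hbj' : ¬ b (j + 1) := fun h => ((hbs j).1 h).elim hbj hl
          simp only [hbj, hbj', if_false] at ih ⊢
          have herr : p * g κ * (m (j + 1) - m j) * (m j ^ (p - 1) - m (j + 1) ^ (p - 1))
              ≤ p * g κ * η * (m j ^ (p - 1) - m (j + 1) ^ (p - 1)) := by
            have h3 := sub_nonneg.2 (hpw j)
            have h4 := not_lt.1 hl
            gcongr
          linarith
  have hk := key j
  have hmp : 0 ≤ m j ^ (p - 1) := Real.rpow_nonneg (hm0 _).le _
  have hη3 : 0 ≤ p * g κ * η * m j ^ (p - 1) := by positivity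
  split_ifs at hk ⊢ with h
  · have : p * g κ * ε ^ (p - 1) * (-y j) ≤ p * g κ * ε ^ (p - 1) * |y j| := by
      gcongr; exact neg_le_abs _
    linarith
  · have : 0 ≤ p * (y j + m j) * m j ^ (p - 1) * g (z j / m j) := by
      have := hmy j
      have := hg0 (z j / m j)
      have : 0 ≤ y j + m j := by linarith
      positivity
    linarith

theorem pathwise_rpow_bound {p : ℝ} (hp : 0 < p) (hp1 : p < 1) {y m : ℕ → ℝ} (hy : y 0 = 0)
    (hm : m = runMax 1 (-y)) (j : ℕ) :
    (1 - p) * m j ^ p ≤ 1 + p * |y j|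
      + ∑ i ∈ Finset.range j, p * (1 - m i ^ (p - 1)) * (y (i + 1) - y i) := by
  have hm1 : ∀ j, 1 ≤ m j := fun j => by rw [hm]; exact le_runMax_init _ _ _
  have key : ∀ j, (1 - p) * m j ^ p - p * m j ^ (p - 1) * y j ≤ (1 - p) - p * y j
      + ∑ i ∈ Finset.range j, p * (1 - m i ^ (p - 1)) * (y (i + 1) - y i) := by
    intro j
    induction j with
    | zero =>
      have em : m 0 = 1 := by rw [hm]; rfl
      simp [em, hy]
    | succ j ih =>
      rw [Finset.sum_range_succ]
      have hs : m (j + 1) = max (m j) (-y (j + 1)) := by rw [hm]; rfl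
      rcases le_total (-y (j + 1)) (m j) with h | h
      · rw [max_eq_left h] at hs
        rw [hs]
        linarith
      · rw [max_eq_right h] at hs
        have h0 : 0 < m j := by linarith [hm1 j]
        have h0' : 0 < m (j + 1) := by linarith [hm1 (j + 1)]
        have := rpow_le_tangent hp hp1 h0 h0'
        have e : m (j + 1) ^ (p - 1) * y (j + 1) = - m (j + 1) ^ p := by
          rw [Real.rpow_sub_one h0'.ne', show y (j + 1) = - m (j + 1) by linarith]
          field_simp
        have e2 : m j ^ (p - 1) * m j = m j ^ p := by
          rw [Real.rpow_sub_one h0.ne']; field_simp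
        have e3 : p * m (j + 1) ^ (p - 1) * y (j + 1) = p * (- m (j + 1) ^ p) := by
          rw [mul_assoc, e]
        have e4 : p * m j ^ (p - 1) * m j = p * m j ^ p := by rw [mul_assoc, e2]
        rw [e3]
        rw [show y (j + 1) = - m (j + 1) by linarith]
        linarith
  have h1 : m j ^ (p - 1) ≤ 1 := Real.rpow_le_one_of_one_le_of_nonpos (hm1 j) (by linarith)
  have h0 : 0 ≤ m j ^ (p - 1) := Real.rpow_nonneg (by linarith [hm1 j]) _
  have h2 : p * (1 - m j ^ (p - 1)) * (-y j) ≤ p * 1 * |y j| := by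
    have h3 : 0 ≤ 1 - m j ^ (p - 1) := by linarith
    calc p * (1 - m j ^ (p - 1)) * (-y j) ≤ p * (1 - m j ^ (p - 1)) * |y j| := by
          gcongr; exact neg_le_abs _
      _ ≤ p * 1 * |y j| := by gcongr; linarith
  linarith [key j]

/-- The tail integral `∫_u^∞ s ^ (p - 1) / (s + 1) ds`, with `u` cut off from below at `κ`. -/
noncomputable def tailInt (p κ u : ℝ) : ℝ :=
  ∫ s in Set.Ioi (max κ u), s ^ (p - 1) / (s + 1)

theorem integrableOn_tail {p a : ℝ} (hp1 : p < 1) (ha : 0 < a) :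
    IntegrableOn (fun s : ℝ => s ^ (p - 1) / (s + 1)) (Ioi a) := by
  have h := integrableOn_Ioi_rpow_of_lt (a := p - 2) (by linarith) ha
  refine Integrable.mono' h (Measurable.aestronglyMeasurable (by fun_prop)) ?_
  filter_upwards [ae_restrict_mem measurableSet_Ioi] with s hs
  have hs0 : 0 < s := ha.trans hs
  rw [Real.norm_of_nonneg (by positivity), show p - 2 = p - 1 - 1 by ring,
    Real.rpow_sub_one hs0.ne' (p - 1)]
  gcongr
  linarith

theorem tail_nonneg {a : ℝ} (p : ℝ) (ha : 0 < a) {s : ℝ} (hs : s ∈ Ioi a) :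
    0 ≤ s ^ (p - 1) / (s + 1) := by
  have : 0 < s := ha.trans hs
  positivity

theorem tailInt_nonneg {p κ : ℝ} (hκ : 0 < κ) (u : ℝ) : 0 ≤ tailInt p κ u :=
  setIntegral_nonneg measurableSet_Ioi fun _ hs => tail_nonneg p (lt_max_of_lt_left hκ) hs

theorem tailInt_antitone {p κ : ℝ} (hp1 : p < 1) (hκ : 0 < κ) : Antitone (tailInt p κ) := by
  intro a b hab
  refine setIntegral_mono_set (integrableOn_tail hp1 (lt_max_of_lt_left hκ)) ?_ ?_
  · filter_upwards [ae_restrict_mem measurableSet_Ioi] with s hs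
    exact tail_nonneg p (lt_max_of_lt_left hκ) hs
  · exact (Ioi_subset_Ioi (max_le_max_left κ hab)).eventuallyLE

theorem rpow_sub_rpow_le_tailInt {p κ : ℝ} (hp : 0 < p) (hp1 : p < 1) (hκ : 0 < κ) (a b : ℝ)
    (ha : κ ≤ a) (hab : a ≤ b) :
    b ^ p - a ^ p ≤ p * (b + 1) * (tailInt p κ a - tailInt p κ b) := by
  have ha0 : 0 < a := hκ.trans_le ha
  have hb0 : 0 < b := ha0.trans_le hab
  have e : tailInt p κ a - tailInt p κ b = ∫ s in a..b, s ^ (p - 1) / (s + 1) := by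
    rw [tailInt, tailInt, max_eq_right ha, max_eq_right (ha.trans hab)]
    rw [← intervalIntegral.integral_Ioi_sub_Ioi (integrableOn_tail hp1 ha0) hab]
  have h1 : ∫ s in a..b, s ^ (p - 1) / (b + 1) ≤ ∫ s in a..b, s ^ (p - 1) / (s + 1) := by
    refine intervalIntegral.integral_mono_on hab ?_ ?_ ?_
    · exact (intervalIntegral.intervalIntegrable_rpow' (by linarith)).div_const _
    · rw [intervalIntegrable_iff_integrableOn_Ioc_of_le hab]
      exact (integrableOn_tail hp1 ha0).mono_set Ioc_subset_Ioi_self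
    · intro s hs
      have : 0 < s := ha0.trans_le hs.1
      have := hs.2
      gcongr
  rw [intervalIntegral.integral_div, integral_rpow (Or.inl (by linarith))] at h1
  rw [e]
  rw [sub_add_cancel, div_div, div_le_iff₀ (by positivity)] at h1
  linarith

section Paths

/-- The `i`-th point of the uniform grid of mesh `t / (n + 1)`. -/
noncomputable def gridPt (t : ℝ≥0) (n i : ℕ) : ℝ≥0 := t * (i / (n + 1 : ℕ))

theorem gridPt_mono (t : ℝ≥0) (n : ℕ) : Monotone (gridPt t n) := fun i j h => by
  unfold gridPt; gcongr

theorem gridPt_zero (t : ℝ≥0) (n : ℕ) : gridPt t n 0 = 0 := by simp [gridPt]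

theorem gridPt_last (t : ℝ≥0) (n : ℕ) : gridPt t n (n + 1) = t := by
  unfold gridPt; rw [div_self (by positivity), mul_one]

theorem gridPt_le {t : ℝ≥0} {n i : ℕ} (h : i ≤ n + 1) : gridPt t n i ≤ t :=
  (gridPt_mono t n h).trans_eq (gridPt_last t n)

theorem gridPt_succ (t : ℝ≥0) (n i : ℕ) :
    gridPt t n (i + 1) = gridPt t n i + t / (n + 1 : ℕ) := by
  unfold gridPt; push_cast; ring

theorem exists_gridPt_ge {t s : ℝ≥0} (hs : s ≤ t) (n : ℕ) :
    ∃ i ≤ n + 1, s ≤ gridPt t n i ∧ gridPt t n i ≤ s + t / (n + 1 : ℕ) := by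
  classical
  have hex : ∃ i, s ≤ gridPt t n i := ⟨n + 1, by rwa [gridPt_last]⟩
  refine ⟨Nat.find hex, Nat.find_min' hex (by rwa [gridPt_last]), Nat.find_spec hex, ?_⟩
  rcases h : Nat.find hex with _ | k
  · rw [gridPt_zero]; positivity
  · rw [gridPt_succ]
    have : ¬ s ≤ gridPt t n k := Nat.find_min hex (by omega)
    gcongr
    exact (not_le.1 this).le

theorem tendsto_mesh (t : ℝ≥0) : Tendsto (fun n : ℕ => t / (n + 1 : ℕ)) atTop (nhds 0) :=
  (tendsto_const_div_atTop_nhds_zero_nat t).comp (tendsto_add_atTop_nat 1)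

theorem bddAbove_range_max {f : ℝ≥0 → ℝ} {t : ℝ≥0} (hbdd : BddAbove (f '' Icc 0 t)) :
    BddAbove (range fun s : Icc (0 : ℝ≥0) t => max (f s.1) 0) := by
  obtain ⟨B, hB⟩ := hbdd
  refine ⟨max B 0, ?_⟩
  rintro _ ⟨s, rfl⟩
  exact max_le_max_right _ (hB ⟨s.1, s.2, rfl⟩)

theorem runMax_grid_le {f : ℝ≥0 → ℝ} {t : ℝ≥0} (hbdd : BddAbove (f '' Icc 0 t)) (a : ℝ) (n : ℕ) :
    runMax a (fun i => f (gridPt t n i)) (n + 1)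
      ≤ max a (⨆ s : Icc (0 : ℝ≥0) t, max (f s.1) 0) := by
  refine runMax_le (le_max_left _ _) fun i hi => le_trans ?_ (le_max_right _ _)
  exact (le_max_left _ _).trans
    (le_ciSup (bddAbove_range_max hbdd) ⟨gridPt t n i, by simp, gridPt_le hi⟩)

theorem tendsto_runMax_grid {f : ℝ≥0 → ℝ} (hrc : ∀ s, ContinuousWithinAt f (Ici s) s)
    {t : ℝ≥0} (hbdd : BddAbove (f '' Icc 0 t)) {a : ℝ} (ha : 0 ≤ a) (h0 : f 0 ≤ a) :
    Tendsto (fun n => runMax a (fun i => f (gridPt t n i)) (n + 1)) atTop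
      (nhds (max a (⨆ s : Icc (0 : ℝ≥0) t, max (f s.1) 0))) := by
  have hne : Nonempty (Icc (0 : ℝ≥0) t) := ⟨⟨0, by simp⟩⟩
  refine tendsto_order.2 ⟨fun b hb => ?_, fun b hb => ?_⟩
  · rcases lt_max_iff.1 hb with hb | hb
    · exact Eventually.of_forall fun n => hb.trans_le (le_runMax_init _ _ _)
    · obtain ⟨⟨s, hs⟩, hbs⟩ := exists_lt_of_lt_ciSup hb
      rcases lt_max_iff.1 hbs with hbs | hbs
      · choose i hi hsi his using exists_gridPt_ge (t := t) hs.2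
        have hlim : Tendsto (fun n => gridPt t n (i n)) atTop (nhdsWithin s (Ici s)) := by
          refine tendsto_nhdsWithin_iff.2 ⟨?_, Eventually.of_forall hsi⟩
          refine tendsto_of_tendsto_of_tendsto_of_le_of_le tendsto_const_nhds ?_ hsi his
          simpa using (tendsto_mesh t).const_add s
        have := (hrc s).tendsto.comp hlim
        filter_upwards [this.eventually_const_lt hbs] with n hn
        refine hn.trans_le (le_runMax (y := fun i => f (gridPt t n i)) ?_ (hi n))
        simpa [gridPt_zero] using h0
      · exact Eventually.of_forall fun n => (hbs.trans_le ha).trans_le (le_runMax_init _ _ _)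
  · exact Eventually.of_forall fun n => (runMax_grid_le hbdd a n).trans_lt hb

variable {f : ℝ≥0 → ℝ}

theorem exists_leftLim (t : ℝ≥0)
    (hll : ∀ t : ℝ≥0, 0 < t → ∃ l : ℝ, Tendsto f (nhdsWithin t (Iio t)) (nhds l))
    (hjump : ∀ t : ℝ≥0, 0 < t → ∀ l : ℝ, Tendsto f (nhdsWithin t (Iio t)) (nhds l) → l ≤ f t) :
    ∃ l ≤ f t, Tendsto f (nhdsWithin t (Iio t)) (nhds l) := by
  rcases eq_or_lt_of_le (zero_le : 0 ≤ t) with h | h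
  · refine ⟨f t, le_rfl, ?_⟩
    have : Iio t = ∅ := by rw [← h]; ext; simp
    simp [this]
  · obtain ⟨l, hl⟩ := hll t h
    exact ⟨l, hjump t h l hl, hl⟩

theorem nhds_split (hrc : ∀ s, ContinuousWithinAt f (Ici s) s) {t : ℝ≥0} {l : ℝ} (hl : Tendsto f (nhdsWithin t (Iio t)) (nhds l))
    {e : ℝ} (he : 0 < e) :
    ∀ᶠ s in nhds t, (s < t → |f s - l| < e) ∧ (t ≤ s → |f s - f t| < e) := by
  have h1 : ∀ᶠ s in nhds t, s ∈ Iio t → |f s - l| < e :=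
    eventually_nhdsWithin_iff.1 (hl.eventually (eventually_abs_sub_lt l he))
  have h2 : ∀ᶠ s in nhds t, s ∈ Ici t → |f s - f t| < e :=
    eventually_nhdsWithin_iff.1 ((hrc t).tendsto.eventually (eventually_abs_sub_lt (f t) he))
  filter_upwards [h1, h2] with s a b using ⟨a, b⟩

theorem bddAbove_abs_image (hrc : ∀ s, ContinuousWithinAt f (Ici s) s)
    (hleft : ∀ t, ∃ l ≤ f t, Tendsto f (nhdsWithin t (Iio t)) (nhds l)) (t : ℝ≥0) :
    BddAbove ((fun s => |f s|) '' Icc 0 t) := by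
  refine isCompact_Icc.induction_on (p := fun s => BddAbove ((fun s => |f s|) '' s)) (by simp)
    (fun s u hsu hu => hu.mono (image_mono hsu))
    (fun s u hs hu => by rw [image_union]; exact hs.union hu) ?_
  intro r _
  obtain ⟨l, -, hl⟩ := hleft r
  refine ⟨_, nhdsWithin_le_nhds (nhds_split hrc hl one_pos), max (|l| + 1) (|f r| + 1), ?_⟩
  rintro _ ⟨s, ⟨h1, h2⟩, rfl⟩
  rcases lt_or_ge s r with h | h
  · have := abs_sub_abs_le_abs_sub (f s) l
    have := h1 h
    exact le_max_of_le_left (by simp only; linarith)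
  · have := abs_sub_abs_le_abs_sub (f s) (f r)
    have := h2 h
    exact le_max_of_le_right (by simp only; linarith)

/-- On compact intervals, a càdlàg function without negative jumps cannot drop by more than `η`
over short time intervals. -/
theorem exists_uniform_no_drop (hrc : ∀ s, ContinuousWithinAt f (Ici s) s)
    (hleft : ∀ t, ∃ l ≤ f t, Tendsto f (nhdsWithin t (Iio t)) (nhds l)) (t : ℝ≥0)
    {η : ℝ} (hη : 0 < η) :
    ∃ δ > 0, ∀ s ≤ t, ∀ u, s ≤ u → dist u s < δ → f s - f u ≤ η := by
  have hloc : ∀ r : ℝ≥0, ∃ c : Set ℝ≥0, IsOpen c ∧ r ∈ c ∧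
      ∀ s ∈ c, ∀ u ∈ c, s ≤ u → f s - f u ≤ η := by
    intro r
    obtain ⟨l, hlr, hl⟩ := hleft r
    obtain ⟨c, hc, hco, hrc'⟩ := eventually_nhds_iff.1 (nhds_split hrc hl (half_pos hη))
    refine ⟨c, hco, hrc', fun s hs u hu hsu => ?_⟩
    obtain ⟨s1, s2⟩ := hc s hs
    obtain ⟨u1, u2⟩ := hc u hu
    rcases lt_or_ge s r with h | h
    · have hs' := abs_lt.1 (s1 h)
      rcases lt_or_ge u r with h' | h'
      · have hu' := abs_lt.1 (u1 h')
        linarith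
      · have hu' := abs_lt.1 (u2 h')
        linarith
    · have hs' := abs_lt.1 (s2 h)
      have hu' := abs_lt.1 (u2 (h.trans hsu))
      linarith
  choose c hco hrcc hc using hloc
  obtain ⟨δ, hδ, h⟩ := lebesgue_number_lemma_of_metric (isCompact_Icc (a := (0 : ℝ≥0)) (b := t)) hco
    (fun r _ => mem_iUnion.2 ⟨r, hrcc r⟩)
  refine ⟨δ, hδ, fun s hs u hsu hd => ?_⟩
  obtain ⟨r, hr⟩ := h s ⟨zero_le, hs⟩
  exact hc r s (hr (Metric.mem_ball_self hδ)) u (hr hd) hsu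

theorem eventually_runMax_grid_step_le (hrc : ∀ s, ContinuousWithinAt f (Ici s) s)
    (hleft : ∀ t, ∃ l ≤ f t, Tendsto f (nhdsWithin t (Iio t)) (nhds l)) (t : ℝ≥0)
    {ε η : ℝ} (hε : 0 ≤ ε) (hη : 0 < η) (h0 : f 0 = 0) :
    ∀ᶠ n in atTop, ∀ i < n + 1, runMax ε (-fun j => f (gridPt t n j)) (i + 1)
      - runMax ε (-fun j => f (gridPt t n j)) i ≤ η := by
  obtain ⟨δ, hδ, h⟩ := exists_uniform_no_drop hrc hleft t hη
  have hmesh := (tendsto_mesh t).eventually (Metric.ball_mem_nhds 0 hδ)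
  filter_upwards [hmesh] with n hn i hi
  have hd := h (gridPt t n i) (gridPt_le hi.le) (gridPt t n (i + 1)) (gridPt_mono t n (Nat.le_succ i))
    (by
      rw [gridPt_succ]
      simpa [NNReal.dist_eq] using hn)
  have h1 : (-fun j => f (gridPt t n j)) i ≤ runMax ε (-fun j => f (gridPt t n j)) i :=
    le_runMax (by simp [gridPt_zero, h0, hε]) le_rfl
  rw [sub_le_iff_le_add, runMax]
  simp only [Pi.neg_apply] at h1 ⊢
  exact max_le (by linarith) (by linarith)

end Paths

section Discrete

variable {Ω : Type*} {m0 : MeasurableSpace Ω} {P : Measure Ω} {F : Filtration ℕ m0}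
  {Y : ℕ → Ω → ℝ}

theorem measurable_runMax (hY : ∀ i, Measurable[F i] (Y i)) (a : ℝ) (j : ℕ) :
    Measurable[F j] fun ω => runMax a (fun i => Y i ω) j := by
  induction j with
  | zero => exact measurable_const
  | succ j ih => exact (ih.mono (F.mono (Nat.le_succ j)) le_rfl).max (hY (j + 1))

theorem integrable_runMax [IsFiniteMeasure P] (hY : ∀ i, Integrable (Y i) P) (a : ℝ) (j : ℕ) :
    Integrable (fun ω => runMax a (fun i => Y i ω) j) P := by
  induction j with
  | zero => exact integrable_const a
  | succ j ih => exact ih.sup (hY (j + 1))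

theorem integrable_rpow_of_integrable [IsFiniteMeasure P] {p : ℝ} (hp : 0 < p) (hp1 : p < 1)
    {f : Ω → ℝ} (hf : Integrable f P) (hf0 : ∀ ω, 0 ≤ f ω) : Integrable (fun ω => f ω ^ p) P := by
  refine Integrable.mono' (hf.add (integrable_const 1))
    (hf.aemeasurable.pow_const p).aestronglyMeasurable (Eventually.of_forall fun ω => ?_)
  rw [Real.norm_of_nonneg (Real.rpow_nonneg (hf0 ω) p)]
  simp only [Pi.add_apply]
  rcases le_total (f ω) 1 with h | h
  · have := Real.rpow_le_one (hf0 ω) h hp.le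
    linarith [hf0 ω]
  · have := Real.rpow_le_rpow_of_exponent_le h hp1.le
    rw [Real.rpow_one] at this
    linarith

theorem integral_weighted_sum_nonpos [IsFiniteMeasure P] (hY : Supermartingale Y F P)
    {H : ℕ → Ω → ℝ} {R : ℝ} (hH : ∀ i, Measurable[F i] (H i)) (hH0 : ∀ i ω, 0 ≤ H i ω)
    (hHR : ∀ i ω, H i ω ≤ R) (N : ℕ) :
    Integrable (fun ω => ∑ i ∈ Finset.range N, H i ω * (Y (i + 1) ω - Y i ω)) P ∧
      ∫ ω, ∑ i ∈ Finset.range N, H i ω * (Y (i + 1) ω - Y i ω) ∂P ≤ 0 := by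
  have hs := hY.neg.sum_mul_sub (fun i => (hH i).stronglyMeasurable) hHR hH0
  have e : (fun ω => ∑ i ∈ Finset.range N, H i ω * (Y (i + 1) ω - Y i ω))
      = fun ω => -(∑ k ∈ Finset.range N, H k * ((-Y) (k + 1) - (-Y) k)) ω := by
    ext ω
    simp only [Finset.sum_apply, Pi.mul_apply, Pi.sub_apply, Pi.neg_apply, ← Finset.sum_neg_distrib]
    refine Finset.sum_congr rfl fun i _ => by ring
  rw [e]
  refine ⟨(hs.integrable N).neg, ?_⟩
  rw [integral_neg]
  have := hs.setIntegral_le (Nat.zero_le N) MeasurableSet.univ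
  simp only [Finset.range_zero, Finset.sum_empty, setIntegral_univ, Pi.zero_apply,
    integral_zero] at this
  linarith

theorem integral_runMax_rpow_le [IsProbabilityMeasure P] {p : ℝ} (hp : 0 < p) (hp1 : p < 1)
    (hY : Supermartingale Y F P) (hY0 : ∀ᵐ ω ∂P, Y 0 ω = 0) (N : ℕ) :
    (1 - p) * ∫ ω, runMax 1 (-fun i => Y i ω) N ^ p ∂P ≤ 1 + p * ∫ ω, |Y N ω| ∂P := by
  set m : ℕ → Ω → ℝ := fun j ω => runMax 1 (-fun i => Y i ω) j with hm
  have hmF : ∀ j, Measurable[F j] (m j) := fun j =>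
    measurable_runMax (Y := fun i ω => -Y i ω) (fun i => (hY.1 i).measurable.neg) 1 j
  have hmi : ∀ j, Integrable (m j) P := fun j =>
    integrable_runMax (Y := fun i ω => -Y i ω) (fun i => (hY.integrable i).neg) 1 j
  have hm1 : ∀ j ω, 1 ≤ m j ω := fun j ω => le_runMax_init _ _ _
  have hw := integral_weighted_sum_nonpos hY (H := fun i ω => p * (1 - m i ω ^ (p - 1))) (R := p)
    (fun i => (measurable_const.sub ((hmF i).pow_const (p - 1))).const_mul p)
    (fun i ω => mul_nonneg hp.le (sub_nonneg.2
      (Real.rpow_le_one_of_one_le_of_nonpos (hm1 i ω) (by linarith))))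
    (fun i ω => by
      have : 0 ≤ m i ω ^ (p - 1) := Real.rpow_nonneg (by linarith [hm1 i ω]) _
      nlinarith) N
  have hint := integrable_rpow_of_integrable hp hp1 (hmi N) fun ω => by linarith [hm1 N ω]
  have hle : ∀ᵐ ω ∂P, (1 - p) * m N ω ^ p ≤ (1 + p * |Y N ω|)
      + ∑ i ∈ Finset.range N, p * (1 - m i ω ^ (p - 1)) * (Y (i + 1) ω - Y i ω) := by
    filter_upwards [hY0] with ω hω
    exact pathwise_rpow_bound hp hp1 (y := fun i => Y i ω) (m := fun j => m j ω) hω rfl N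
  have hYa : Integrable (fun ω => p * |Y N ω|) P := (hY.integrable N).abs.const_mul p
  have hI : Integrable (fun ω => 1 + p * |Y N ω|) P := (integrable_const 1).add hYa
  have := integral_mono_ae (hint.const_mul (1 - p)) (hI.add hw.1) hle
  simp only [Pi.add_apply] at this
  rw [integral_const_mul, integral_add hI hw.1, integral_add (integrable_const 1) hYa,
    integral_const_mul] at this
  simp only [integral_const, probReal_univ, smul_eq_mul, mul_one] at this
  linarith [hw.2]

open Classical in
theorem integral_discrete_le [IsProbabilityMeasure P] {p κ ε η : ℝ} (hp : 0 < p) (hp1 : p < 1)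
    (hκ : 0 < κ) (hε : 0 < ε) (hη : 0 < η)
    (hY : Supermartingale Y F P) (hY0 : ∀ᵐ ω ∂P, Y 0 ω = 0) (N : ℕ) {m : ℕ → Ω → ℝ}
    (hm : m = fun j ω => runMax ε (-fun i => Y i ω) j)
    {f : Ω → ℝ} (hf : f = fun ω => if ∃ i < N, η < m (i + 1) ω - m i ω then 0
      else max (runMax 0 (fun i => Y i ω) N) (κ * m N ω) ^ p) :
    Measurable f ∧ ∫⁻ ω, ENNReal.ofReal (f ω) ∂P ≤ ENNReal.ofReal
      ((κ ^ p + tailInt p κ κ) * ∫ ω, m N ω ^ p ∂P + p * tailInt p κ κ * ε ^ (p - 1) * η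
        + p * tailInt p κ κ * ε ^ (p - 1)
          * ∫ ω, (if ∃ i < N, η < m (i + 1) ω - m i ω then |Y N ω| else 0) ∂P) := by
  have hmF : ∀ j, Measurable[F j] (m j) := fun j => by
    rw [hm]
    exact measurable_runMax (Y := fun i ω => -Y i ω) (fun i => (hY.1 i).measurable.neg) ε j
  have hmi : ∀ j, Integrable (m j) P := fun j => by
    rw [hm]
    exact integrable_runMax (Y := fun i ω => -Y i ω) (fun i => (hY.integrable i).neg) ε j
  have hmε : ∀ j ω, ε ≤ m j ω := fun j ω => by rw [hm]; exact le_runMax_init _ _ _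
  have hm0 : ∀ j ω, 0 < m j ω := fun j ω => hε.trans_le (hmε j ω)
  set z : ℕ → Ω → ℝ := fun j ω => max (runMax 0 (fun i => Y i ω) j) (κ * m j ω) with hz
  have hzF : ∀ j, Measurable[F j] (z j) := fun j =>
    (measurable_runMax (fun i => (hY.1 i).measurable) 0 j).max ((hmF j).const_mul κ)
  have hzi : Integrable (z N) P := (integrable_runMax hY.integrable 0 N).sup ((hmi N).const_mul κ)
  set b : ℕ → Ω → Prop := fun j ω => ∃ i < j, η < m (i + 1) ω - m i ω with hb
  have hbF : ∀ j, MeasurableSet[F j] {ω | b j ω} := fun j => by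
    have e : {ω | b j ω} = ⋃ i ∈ Finset.range j, {ω | η < m (i + 1) ω - m i ω} := by
      ext ω; simp [hb]
    rw [e]
    refine Finset.measurableSet_biUnion _ fun i hi => ?_
    have hij : i + 1 ≤ j := Finset.mem_range.1 hi
    exact measurableSet_lt measurable_const
      (((hmF (i + 1)).mono (F.mono hij) le_rfl).sub
        ((hmF i).mono (F.mono ((Nat.le_succ i).trans hij)) le_rfl))
  set g := tailInt p κ with hg
  set C := p * g κ * ε ^ (p - 1) with hC
  have hg0 : ∀ u, 0 ≤ g u := tailInt_nonneg hκ
  have hga : Antitone g := tailInt_antitone hp1 hκ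
  have hgκ := hg0 κ
  have hC0 : 0 ≤ C := by positivity
  set H : ℕ → Ω → ℝ := fun j ω =>
    if b j ω then C else p * m j ω ^ (p - 1) * g (z j ω / m j ω) with hH
  have hHF : ∀ j, Measurable[F j] (H j) := fun j =>
    Measurable.ite (hbF j) measurable_const
      ((((hmF j).pow_const (p - 1)).const_mul p).mul (hga.measurable.comp ((hzF j).div (hmF j))))
  have hH0 : ∀ j ω, 0 ≤ H j ω := fun j ω => by
    simp only [hH]
    have := hm0 j ω
    have := hg0 (z j ω / m j ω)
    split_ifs <;> positivity
  have hHC : ∀ j ω, H j ω ≤ C := fun j ω => by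
    simp only [hH]
    split_ifs
    · exact le_rfl
    · have h1 : g (z j ω / m j ω) ≤ g κ := by
        refine hga ?_
        rw [le_div_iff₀ (hm0 j ω)]
        exact le_max_right _ _
      have h2 : m j ω ^ (p - 1) ≤ ε ^ (p - 1) :=
        Real.rpow_le_rpow_of_nonpos hε (hmε j ω) (by linarith)
      have h3 := (hm0 j ω).le
      calc p * m j ω ^ (p - 1) * g (z j ω / m j ω) ≤ p * ε ^ (p - 1) * g κ := by
            have := hg0 (z j ω / m j ω)
            gcongr
        _ = C := by rw [hC]; ring
  have hw := integral_weighted_sum_nonpos hY hHF hH0 hHC N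
  have hz0 : ∀ ω, 0 ≤ z N ω := fun ω => (le_runMax_init 0 _ N).trans (le_max_left _ _)
  have hbN : MeasurableSet {ω | b N ω} := F.le N _ (hbF N)
  have hfm : Measurable f := by
    rw [hf]
    exact Measurable.ite hbN measurable_const (((hzF N).mono (F.le N) le_rfl).pow_const p)
  have hf0 : ∀ ω, 0 ≤ f ω := fun ω => by
    rw [hf]
    have := Real.rpow_nonneg (hz0 ω) p
    change 0 ≤ if _ then _ else z N ω ^ p
    split_ifs
    · exact le_rfl
    · exact this
  have hfi : Integrable f P := by
    refine (integrable_rpow_of_integrable hp hp1 hzi hz0).mono' hfm.aestronglyMeasurable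
      (Eventually.of_forall fun ω => ?_)
    rw [Real.norm_of_nonneg (hf0 ω), hf]
    have := Real.rpow_nonneg (hz0 ω) p
    change (if _ then _ else z N ω ^ p) ≤ _
    split_ifs
    · exact this
    · exact le_rfl
  refine ⟨hfm, ?_⟩
  rw [← ofReal_integral_eq_lintegral_ofReal hfi (Eventually.of_forall hf0)]
  refine ENNReal.ofReal_le_ofReal ?_
  have hle : ∀ᵐ ω ∂P, f ω ≤ (((κ ^ p + g κ) * m N ω ^ p
      + ∑ i ∈ Finset.range N, H i ω * (Y (i + 1) ω - Y i ω)) + C * η)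
      + C * (if b N ω then |Y N ω| else 0) := by
    filter_upwards [hY0] with ω hω
    rw [hf]
    exact pathwise_bound (g := g) (y := fun i => Y i ω) (m := fun i => m i ω)
      (z := fun i => z i ω) (H := fun i => H i ω) (b := fun i => b i ω) hp hp1 hκ hε hη hg0 hga
      (rpow_sub_rpow_le_tailInt hp hp1 hκ) hω (by rw [hm]) rfl (fun j => Iff.rfl)
      (fun j => rfl) N
  have i1 : Integrable (fun ω => (κ ^ p + g κ) * m N ω ^ p) P :=
    (integrable_rpow_of_integrable hp hp1 (hmi N) fun ω => (hm0 N ω).le).const_mul _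
  have i2 : Integrable (fun ω => if b N ω then |Y N ω| else 0) P :=
    ((hY.integrable N).abs.indicator hbN).congr
      (Eventually.of_forall fun ω => by simp [Set.indicator])
  have i3 : Integrable (fun ω => (κ ^ p + g κ) * m N ω ^ p
      + ∑ i ∈ Finset.range N, H i ω * (Y (i + 1) ω - Y i ω)) P := i1.add hw.1
  have i4 : Integrable (fun ω => (κ ^ p + g κ) * m N ω ^ p
      + ∑ i ∈ Finset.range N, H i ω * (Y (i + 1) ω - Y i ω) + C * η) P :=
    i3.add (integrable_const (C * η))
  have := integral_mono_ae hfi (i4.add (i2.const_mul C)) hle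
  simp only [Pi.add_apply] at this
  rw [integral_add i4 (i2.const_mul C), integral_add i3 (integrable_const _),
    integral_add i1 hw.1, integral_const_mul, integral_const_mul, integral_const_mul] at this
  simp only [integral_const, probReal_univ, smul_eq_mul, one_mul] at this
  linarith [hw.2]

end Discrete

section Continuous

variable {Ω : Type*} {m0 : MeasurableSpace Ω} {P : Measure Ω} {ℱ : Filtration ℝ≥0 m0}
  {X : ℝ≥0 → Ω → ℝ}

/-- The filtration `ℱ` observed along the uniform grid. -/
noncomputable def gridFiltration (ℱ : Filtration ℝ≥0 m0) (t : ℝ≥0) (n : ℕ) : Filtration ℕ m0 where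
  seq i := ℱ (gridPt t n i)
  mono' _ _ hij := ℱ.mono (gridPt_mono t n hij)
  le' _ := ℱ.le _

theorem supermartingale_grid (hX : Supermartingale X ℱ P) (t : ℝ≥0) (n : ℕ) :
    Supermartingale (fun i => X (gridPt t n i)) (gridFiltration ℱ t n) P :=
  ⟨fun _ => hX.1 _, fun _ _ hij => hX.2.1 _ _ (gridPt_mono t n hij), fun _ => hX.2.2 _⟩

theorem neg_iInf_min (f : ℝ≥0 → ℝ) (t : ℝ≥0) :
    -(⨅ s : Icc (0 : ℝ≥0) t, min (f s.1) 0) = ⨆ s : Icc (0 : ℝ≥0) t, max (-f s.1) 0 := by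
  rw [iInf, Real.sInf_def, neg_neg, iSup]
  congr 1
  ext x
  simp only [Set.mem_neg, Set.mem_range]
  refine exists_congr fun s => ?_
  rw [← neg_eq_iff_eq_neg, ← max_neg_neg, neg_zero]

theorem integrable_runInf_rpow [IsProbabilityMeasure P] (hX : Supermartingale X ℱ P)
    (hX0 : ∀ᵐ ω ∂P, X 0 ω = 0) (hrc : ∀ ω t, ContinuousWithinAt (fun s => X s ω) (Ici t) t)
    {t : ℝ≥0} (hbdd : ∀ ω, BddAbove ((fun s => -X s ω) '' Icc 0 t))
    {p : ℝ} (hp : 0 < p) (hp1 : p < 1) :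
    Integrable (fun ω => (⨆ s : Icc (0 : ℝ≥0) t, max (-X s.1 ω) 0) ^ p) P := by
  set I : Ω → ℝ := fun ω => ⨆ s : Icc (0 : ℝ≥0) t, max (-X s.1 ω) 0 with hI
  have hI0 : ∀ ω, 0 ≤ I ω := fun ω => Real.iSup_nonneg fun s => le_max_right _ _
  have hlim : ∀ a, 0 ≤ a → ∀ᵐ ω ∂P, Tendsto
      (fun n => runMax a (-fun i => X (gridPt t n i) ω) (n + 1)) atTop (nhds (max a (I ω))) := by
    intro a ha
    filter_upwards [hX0] with ω hω
    exact tendsto_runMax_grid (f := fun s => -X s ω) (fun s => (hrc ω s).neg) (hbdd ω) ha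
      (by simp [hω, ha])
  have hmeas : ∀ a n, Measurable fun ω => runMax a (-fun i => X (gridPt t n i) ω) (n + 1) :=
    fun a n => (measurable_runMax (Y := fun i ω => -X (gridPt t n i) ω) (F := gridFiltration ℱ t n)
      (fun i => (hX.1 _).measurable.neg) a (n + 1)).mono ((gridFiltration ℱ t n).le _) le_rfl
  have hIm : AEMeasurable I P := by
    refine aemeasurable_of_tendsto_metrizable_ae' (fun n => (hmeas 0 n).aemeasurable) ?_
    filter_upwards [hlim 0 le_rfl] with ω hω
    rwa [max_eq_right (hI0 ω)] at hω
  set K : ℝ := (1 + p * ∫ ω, |X t ω| ∂P) / (1 - p) with hK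
  have hfin : ∫⁻ ω, ENNReal.ofReal (I ω ^ p) ∂P ≤ ENNReal.ofReal K := by
    calc ∫⁻ ω, ENNReal.ofReal (I ω ^ p) ∂P
        ≤ ∫⁻ ω, liminf (fun n => ENNReal.ofReal
            (runMax 1 (-fun i => X (gridPt t n i) ω) (n + 1) ^ p)) atTop ∂P := by
          refine lintegral_mono_ae ?_
          filter_upwards [hlim 1 zero_le_one] with ω hω
          rw [(ENNReal.tendsto_ofReal (hω.rpow_const (Or.inr hp.le))).liminf_eq]
          have := hI0 ω
          gcongr
          exact le_max_right _ _
      _ ≤ liminf (fun n => ∫⁻ ω, ENNReal.ofReal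
            (runMax 1 (-fun i => X (gridPt t n i) ω) (n + 1) ^ p) ∂P) atTop :=
          lintegral_liminf_le fun n => ((hmeas 1 n).pow_const p).ennreal_ofReal
      _ ≤ liminf (fun _ : ℕ => ENNReal.ofReal K) atTop := by
          refine liminf_le_liminf (Eventually.of_forall fun n => ?_)
          have h1 : ∀ ω, 0 ≤ runMax 1 (-fun i => X (gridPt t n i) ω) (n + 1) := fun ω =>
            zero_le_one.trans (le_runMax_init _ _ _)
          have hint : Integrable
              (fun ω => runMax 1 (-fun i => X (gridPt t n i) ω) (n + 1) ^ p) P :=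
            integrable_rpow_of_integrable hp hp1 (integrable_runMax (P := P) (Y := fun i ω => -X (gridPt t n i) ω)
              (fun i => (hX.integrable _).neg) 1 (n + 1)) h1
          rw [← ofReal_integral_eq_lintegral_ofReal hint
            (Eventually.of_forall fun ω => Real.rpow_nonneg (h1 ω) p)]
          refine ENNReal.ofReal_le_ofReal ?_
          rw [hK, le_div_iff₀ (by linarith), mul_comm]
          have := integral_runMax_rpow_le hp hp1 (supermartingale_grid hX t n)
            (by simpa [gridPt_zero] using hX0) (n + 1)
          rwa [gridPt_last] at this
      _ = ENNReal.ofReal K := liminf_const _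
  refine ⟨(hIm.pow_const p).aestronglyMeasurable, ?_⟩
  rw [hasFiniteIntegral_iff_ofReal (Eventually.of_forall fun ω => Real.rpow_nonneg (hI0 ω) p)]
  exact hfin.trans_lt ENNReal.ofReal_lt_top

open Classical in
theorem lintegral_runSup_rpow_le [IsProbabilityMeasure P] (hX : Supermartingale X ℱ P)
    (hX0 : ∀ᵐ ω ∂P, X 0 ω = 0) (hrc : ∀ ω t, ContinuousWithinAt (fun s => X s ω) (Ici t) t)
    (hleft : ∀ ω t, ∃ l ≤ X t ω, Tendsto (fun s => X s ω) (nhdsWithin t (Iio t)) (nhds l))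
    (t : ℝ≥0) {p κ ε η : ℝ} (hp : 0 < p) (hp1 : p < 1)
    (hκ : 0 < κ) (hε : 0 < ε) (hη : 0 < η) :
    ∫⁻ ω, ENNReal.ofReal ((⨆ s : Icc (0 : ℝ≥0) t, max (X s.1 ω) 0) ^ p) ∂P ≤ ENNReal.ofReal
      ((κ ^ p + tailInt p κ κ)
          * (ε ^ p + ∫ ω, (⨆ s : Icc (0 : ℝ≥0) t, max (-X s.1 ω) 0) ^ p ∂P)
        + p * tailInt p κ κ * ε ^ (p - 1) * η) := by
  have hbdd : ∀ ω, BddAbove ((fun s => |X s ω|) '' Icc 0 t) := fun ω =>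
    bddAbove_abs_image (hrc ω) (hleft ω) t
  have hbddP : ∀ ω, BddAbove ((fun s => X s ω) '' Icc 0 t) := fun ω => by
    obtain ⟨B, hB⟩ := hbdd ω
    refine ⟨B, ?_⟩
    rintro _ ⟨s, hs, rfl⟩
    exact (le_abs_self _).trans (hB ⟨s, hs, rfl⟩)
  have hbddN : ∀ ω, BddAbove ((fun s => -X s ω) '' Icc 0 t) := fun ω => by
    obtain ⟨B, hB⟩ := hbdd ω
    refine ⟨B, ?_⟩
    rintro _ ⟨s, hs, rfl⟩
    exact (neg_le_abs _).trans (hB ⟨s, hs, rfl⟩)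
  have hIint := integrable_runInf_rpow hX hX0 hrc hbddN hp hp1
  set I : Ω → ℝ := fun ω => ⨆ s : Icc (0 : ℝ≥0) t, max (-X s.1 ω) 0 with hI
  set S : Ω → ℝ := fun ω => ⨆ s : Icc (0 : ℝ≥0) t, max (X s.1 ω) 0 with hS
  have hI0 : ∀ ω, 0 ≤ I ω := fun ω => Real.iSup_nonneg fun s => le_max_right _ _
  have hS0 : ∀ ω, 0 ≤ S ω := fun ω => Real.iSup_nonneg fun s => le_max_right _ _
  set m : ℕ → ℕ → Ω → ℝ := fun n j ω => runMax ε (-fun i => X (gridPt t n i) ω) j with hm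
  set bad : ℕ → Ω → Prop := fun n ω => ∃ i < n + 1, η < m n (i + 1) ω - m n i ω with hbad
  set f : ℕ → Ω → ℝ := fun n ω => if bad n ω then 0
    else max (runMax 0 (fun i => X (gridPt t n i) ω) (n + 1)) (κ * m n (n + 1) ω) ^ p with hf
  have hdisc := fun n => integral_discrete_le (κ := κ) hp hp1 hκ hε hη
    (supermartingale_grid hX t n) (by simpa [gridPt_zero] using hX0) (n + 1) (m := m n) rfl
    (f := f n) rfl
  have hgood : ∀ᵐ ω ∂P, ∀ᶠ n in atTop, ¬ bad n ω := by
    filter_upwards [hX0] with ω hω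
    filter_upwards [eventually_runMax_grid_step_le (hrc ω) (hleft ω) t hε.le hη hω] with n hn
    rintro ⟨i, hi, h⟩
    exact absurd (hn i hi) (not_le.2 h)
  set r : ℕ → ℝ := fun n => ∫ ω, (if bad n ω then |X t ω| else 0) ∂P with hr
  have hmmeas : ∀ n j, Measurable (m n j) := fun n j =>
    (measurable_runMax (Y := fun i ω => -X (gridPt t n i) ω) (F := gridFiltration ℱ t n)
      (fun i => (hX.1 _).measurable.neg) ε j).mono ((gridFiltration ℱ t n).le _) le_rfl
  have hr0 : Tendsto r atTop (nhds 0) := by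
    have hbadm : ∀ n, MeasurableSet {ω | bad n ω} := fun n => by
      have e : {ω | bad n ω}
          = ⋃ i ∈ Finset.range (n + 1), {ω | η < m n (i + 1) ω - m n i ω} := by
        ext ω; simp [hbad]
      rw [e]
      exact Finset.measurableSet_biUnion _ fun i _ =>
        measurableSet_lt measurable_const ((hmmeas n _).sub (hmmeas n _))
    have hXt : Measurable (X t) := (hX.1 t).measurable.mono (ℱ.le t) le_rfl
    rw [← integral_zero Ω ℝ (μ := P)]
    refine tendsto_integral_of_dominated_convergence (fun ω => |X t ω|)
      (fun n => (Measurable.ite (hbadm n) hXt.abs measurable_const).aestronglyMeasurable)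
      (hX.integrable t).abs (fun n => Eventually.of_forall fun ω => ?_) ?_
    · split_ifs <;> simp
    · filter_upwards [hgood] with ω hω
      refine tendsto_const_nhds.congr' ?_
      filter_upwards [hω] with n hn
      rw [if_neg hn]
  have hc0 : 0 ≤ κ ^ p + tailInt p κ κ := by
    have := tailInt_nonneg (p := p) hκ κ
    positivity
  have hmint : ∀ n, ∫ ω, m n (n + 1) ω ^ p ∂P ≤ ε ^ p + ∫ ω, I ω ^ p ∂P := by
    intro n
    have hm0 : ∀ ω, 0 ≤ m n (n + 1) ω := fun ω => hε.le.trans (le_runMax_init _ _ _)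
    have hle : ∀ ω, m n (n + 1) ω ^ p ≤ ε ^ p + I ω ^ p := fun ω => by
      have h1 : m n (n + 1) ω ≤ max ε (I ω) :=
        runMax_grid_le (f := fun s => -X s ω) (hbddN ω) ε n
      have h2 : m n (n + 1) ω ^ p ≤ max ε (I ω) ^ p := by
        have := hm0 ω
        gcongr
      have h3 := Real.rpow_nonneg (hI0 ω) p
      have h4 := Real.rpow_nonneg hε.le p
      refine h2.trans ?_
      rcases max_choice ε (I ω) with h | h <;> rw [h] <;> linarith
    have hmi := integrable_rpow_of_integrable hp hp1
      (integrable_runMax (P := P) (Y := fun i ω => -X (gridPt t n i) ω)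
        (fun i => (hX.integrable _).neg) ε (n + 1)) hm0
    have := integral_mono hmi ((integrable_const (ε ^ p)).add hIint) hle
    simp only [Pi.add_apply] at this
    rw [integral_add (integrable_const _) hIint, integral_const, probReal_univ, one_smul]
      at this
    exact this
  set A : ℝ := (κ ^ p + tailInt p κ κ) * (ε ^ p + ∫ ω, I ω ^ p ∂P)
    + p * tailInt p κ κ * ε ^ (p - 1) * η with hA
  set C : ℝ := p * tailInt p κ κ * ε ^ (p - 1) with hC
  calc ∫⁻ ω, ENNReal.ofReal (S ω ^ p) ∂P
      ≤ ∫⁻ ω, liminf (fun n => ENNReal.ofReal (f n ω)) atTop ∂P := by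
        refine lintegral_mono_ae ?_
        filter_upwards [hX0, hgood] with ω hω hgω
        have hlim := tendsto_runMax_grid (f := fun s => X s ω) (hrc ω) (hbddP ω) le_rfl hω.le
        rw [max_eq_right (hS0 ω)] at hlim
        rw [← (ENNReal.tendsto_ofReal (hlim.rpow_const (Or.inr hp.le))).liminf_eq]
        refine liminf_le_liminf ?_
        filter_upwards [hgω] with n hn
        simp only [hf, if_neg hn]
        have := le_runMax_init 0 (fun i => X (gridPt t n i) ω) (n + 1)
        gcongr
        exact le_max_left _ _
    _ ≤ liminf (fun n => ∫⁻ ω, ENNReal.ofReal (f n ω) ∂P) atTop :=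
        lintegral_liminf_le fun n => (hdisc n).1.ennreal_ofReal
    _ ≤ liminf (fun n => ENNReal.ofReal (A + C * r n)) atTop := by
        refine liminf_le_liminf (Eventually.of_forall fun n => ?_)
        refine (hdisc n).2.trans (ENNReal.ofReal_le_ofReal ?_)
        rw [gridPt_last]
        have := mul_le_mul_of_nonneg_left (hmint n) hc0
        simp only [hA, hr, hbad]
        linarith
    _ = ENNReal.ofReal A := by
        refine (ENNReal.tendsto_ofReal ?_).liminf_eq
        simpa using (hr0.const_mul C).const_add A

end Continuous

/-- Sharp `L^p` bound for the running supremum of a supermartingale with nonnegative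
jumps versus its running infimum: `E[(M⁺_t)^p] ≤ c_p^p·E[(−M⁻_t)^p]` for `0 < p < 1`,
where `c_p^p = (1/p − 1)^p + ∫_{1/p−1}^∞ s^(p−1)/(s+1) ds`. -/
theorem supermartingale_Lp_supremum_infimum_bound
    {Ω : Type*} {m0 : MeasurableSpace Ω} {P : Measure Ω} [IsProbabilityMeasure P]
    (hcomplete : P.IsComplete)
    (ℱ : Filtration ℝ≥0 m0) (X : ℝ≥0 → Ω → ℝ)
    (hsuper : Supermartingale X ℱ P)
    (hX0 : ∀ᵐ ω ∂P, X 0 ω = 0)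
    (hrc : ∀ ω, ∀ t : ℝ≥0, ContinuousWithinAt (fun s => X s ω) (Set.Ici t) t)
    (hll : ∀ ω, ∀ t : ℝ≥0, 0 < t →
      ∃ l : ℝ, Tendsto (fun s => X s ω) (nhdsWithin t (Set.Iio t)) (nhds l))
    (hjump : ∀ ω, ∀ t : ℝ≥0, 0 < t → ∀ l : ℝ,
      Tendsto (fun s => X s ω) (nhdsWithin t (Set.Iio t)) (nhds l) → l ≤ X t ω)
    (p : ℝ) (hp : 0 < p) (hp1 : p < 1)
    (t : ℝ≥0) :
    ∫ ω, (⨆ s : Set.Icc (0 : ℝ≥0) t, max (X s.1 ω) 0) ^ p ∂P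
      ≤ ((1 / p - 1) ^ p + ∫ s in Set.Ioi (1 / p - 1), s ^ (p - 1) / (s + 1))
          * ∫ ω, (-(⨅ s : Set.Icc (0 : ℝ≥0) t, min (X s.1 ω) 0)) ^ p ∂P := by
  have hκ : 0 < 1 / p - 1 := by
    rw [sub_pos, lt_div_iff₀ hp]; linarith
  set κ := 1 / p - 1 with hκdef
  have hleft : ∀ ω t, ∃ l ≤ X t ω,
      Tendsto (fun s => X s ω) (nhdsWithin t (Iio t)) (nhds l) := fun ω t =>
    exists_leftLim t (hll ω) (hjump ω)
  have hJ : ∫ s in Set.Ioi κ, s ^ (p - 1) / (s + 1) = tailInt p κ κ := by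
    rw [tailInt, max_self]
  have hinf : ∀ ω, -(⨅ s : Icc (0 : ℝ≥0) t, min (X s.1 ω) 0)
      = ⨆ s : Icc (0 : ℝ≥0) t, max (-X s.1 ω) 0 := fun ω => neg_iInf_min (fun s => X s ω) t
  simp only [hJ, hinf]
  have hbound := fun ε (hε : 0 < ε) η (hη : 0 < η) =>
    lintegral_runSup_rpow_le hsuper hX0 hrc hleft t (ε := ε) (η := η) hp hp1 hκ hε hη
  set A := ∫ ω, (⨆ s : Icc (0 : ℝ≥0) t, max (-X s.1 ω) 0) ^ p ∂P
  have hA0 : 0 ≤ A := integral_nonneg fun ω =>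
    Real.rpow_nonneg (Real.iSup_nonneg fun s => le_max_right _ _) p
  have hJ0 := tailInt_nonneg (p := p) hκ κ
  have hS0 : ∀ ω, 0 ≤ (⨆ s : Icc (0 : ℝ≥0) t, max (X s.1 ω) 0) ^ p := fun ω =>
    Real.rpow_nonneg (Real.iSup_nonneg fun s => le_max_right _ _) p
  by_cases hint : Integrable (fun ω => (⨆ s : Icc (0 : ℝ≥0) t, max (X s.1 ω) 0) ^ p) P
  swap
  · rw [integral_undef hint]; positivity
  rw [← ofReal_integral_eq_lintegral_ofReal hint (Eventually.of_forall hS0)] at hbound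
  have hε : ∀ ε, 0 < ε → ∫ ω, (⨆ s : Icc (0 : ℝ≥0) t, max (X s.1 ω) 0) ^ p ∂P
      ≤ (κ ^ p + tailInt p κ κ) * (ε ^ p + A) := by
    intro ε hε
    have hlim : Tendsto (fun η : ℝ => (κ ^ p + tailInt p κ κ) * (ε ^ p + A)
        + p * tailInt p κ κ * ε ^ (p - 1) * η) (nhdsWithin 0 (Ioi 0))
        (nhds ((κ ^ p + tailInt p κ κ) * (ε ^ p + A))) := by
      refine tendsto_nhdsWithin_of_tendsto_nhds (Continuous.tendsto' (by fun_prop) _ _ (by simp))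
    refine ge_of_tendsto hlim ?_
    filter_upwards [self_mem_nhdsWithin] with η hη
    have hη' : 0 < η := hη
    exact (ENNReal.ofReal_le_ofReal_iff (by positivity)).1 (hbound ε hε η hη')
  have hlim : Tendsto (fun ε : ℝ => (κ ^ p + tailInt p κ κ) * (ε ^ p + A))
      (nhdsWithin 0 (Ioi 0)) (nhds ((κ ^ p + tailInt p κ κ) * A)) := by
    refine tendsto_nhdsWithin_of_tendsto_nhds (Continuous.tendsto' ?_ _ _ ?_)
    · exact (((Real.continuous_rpow_const hp.le)).add continuous_const).const_mul _
    · simp [Real.zero_rpow hp.ne']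
  refine ge_of_tendsto hlim ?_
  filter_upwards [self_mem_nhdsWithin] with ε h using hε ε h
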